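/- Assume 𝒞(M1,M2) < +∞. Then a random coupling P ∈ RΓ(M1,M2) attains the minimum in 𝒞(M1,M2) = min { ∫ (∫ c dπ) dP(π) : P ∈ RΓ(M1,M2) } if and only if (pr¹_♯, pr²_♯)_♯ P is an optimal coupling for the cost C between M1 and M2 and P is concentrated on the set of c-optimal couplings { π ∈ P(X1×X2) : ∫ c dπ = C(pr¹_♯π, pr²_♯π) }. -/

import Mathlib

open MeasureTheory Topology ENNReal Set

noncomputable section

namespace OTRM

noncomputable instance instMSPM {X : Type*} [MeasurableSpace X] [TopologicalSpace X]
    [OpensMeasurableSpace X] : MeasurableSpace (ProbabilityMeasure X) := borel _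

instance instBSPM {X : Type*} [MeasurableSpace X] [TopologicalSpace X]
    [OpensMeasurableSpace X] : BorelSpace (ProbabilityMeasure X) := ⟨rfl⟩

variable {X1 X2 : Type*}
  [MeasurableSpace X1] [TopologicalSpace X1] [BorelSpace X1] [PolishSpace X1]
  [MeasurableSpace X2] [TopologicalSpace X2] [BorelSpace X2] [PolishSpace X2]

def Coupling {Y1 Y2 : Type*} [MeasurableSpace Y1] [MeasurableSpace Y2]
    (μ1 : ProbabilityMeasure Y1) (μ2 : ProbabilityMeasure Y2) :
    Set (ProbabilityMeasure (Y1 × Y2)) :=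
  {π | (π : Measure (Y1 × Y2)).map Prod.fst = (μ1 : Measure Y1) ∧
       (π : Measure (Y1 × Y2)).map Prod.snd = (μ2 : Measure Y2)}

def transportCost (c : X1 × X2 → ℝ≥0∞) (π : ProbabilityMeasure (X1 × X2)) : ℝ≥0∞ :=
  ∫⁻ p, c p ∂(π : Measure (X1 × X2))

def OTCost (c : X1 × X2 → ℝ≥0∞) (μ1 : ProbabilityMeasure X1) (μ2 : ProbabilityMeasure X2) :
    ℝ≥0∞ :=
  ⨅ π ∈ Coupling μ1 μ2, transportCost c π

/-- First marginal of a transport plan. -/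
def margFst (π : ProbabilityMeasure (X1 × X2)) : ProbabilityMeasure X1 :=
  π.map measurable_fst.aemeasurable

/-- Second marginal of a transport plan. -/
def margSnd (π : ProbabilityMeasure (X1 × X2)) : ProbabilityMeasure X2 :=
  π.map measurable_snd.aemeasurable

/-- The iterated optimal transport cost `𝒞(M1, M2)` between laws of random measures. -/
def IterOTCost (c : X1 × X2 → ℝ≥0∞)
    (M1 : ProbabilityMeasure (ProbabilityMeasure X1))
    (M2 : ProbabilityMeasure (ProbabilityMeasure X2)) : ℝ≥0∞ :=
  ⨅ P ∈ Coupling M1 M2,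
    ∫⁻ p, OTCost c p.1 p.2 ∂(P : Measure (ProbabilityMeasure X1 × ProbabilityMeasure X2))

/-- The set of (laws of) random couplings between `M1` and `M2`. -/
def RandCoupling (M1 : ProbabilityMeasure (ProbabilityMeasure X1))
    (M2 : ProbabilityMeasure (ProbabilityMeasure X2)) :
    Set (ProbabilityMeasure (ProbabilityMeasure (X1 × X2))) :=
  {P | (P : Measure (ProbabilityMeasure (X1 × X2))).map margFst
          = (M1 : Measure (ProbabilityMeasure X1)) ∧
       (P : Measure (ProbabilityMeasure (X1 × X2))).map margSnd
          = (M2 : Measure (ProbabilityMeasure X2))}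


/-- The pair-marginal pushforward `(pr¹_♯, pr²_♯)_♯ P` of a random coupling. -/
def margPairLaw (P : ProbabilityMeasure (ProbabilityMeasure (X1 × X2))) :
    Measure (ProbabilityMeasure X1 × ProbabilityMeasure X2) :=
  (P : Measure (ProbabilityMeasure (X1 × X2))).map fun π => (margFst π, margSnd π)

/-- The set of `c`-optimal couplings (between their own marginals). -/
def OptPlans (c : X1 × X2 → ℝ≥0∞) : Set (ProbabilityMeasure (X1 × X2)) :=
  {π | transportCost c π = OTCost c (margFst π) (margSnd π)}

section helpers

open Filter

/-- Sets of the form `{μ | q < μ G}` with `G` open are open. -/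
lemma isOpen_measure_gt {X : Type*} [MeasurableSpace X] [TopologicalSpace X] [BorelSpace X]
    [PolishSpace X] {G : Set X} (hG : IsOpen G) (q : ℝ≥0∞) :
    IsOpen {μ : ProbabilityMeasure X | q < (μ : Measure X) G} := by
  have : LowerSemicontinuous (fun μ : ProbabilityMeasure X => (μ : Measure X) G) := by
    intro μ
    refine lowerSemicontinuousAt_iff_le_liminf.2 ?_
    exact ProbabilityMeasure.le_liminf_measure_open_of_tendsto tendsto_id hG
  exact this.isOpen_preimage q

/-- The narrow topology on a Polish space is second countable. -/
instance secondCountable_PM {X : Type*} [MeasurableSpace X] [tX : TopologicalSpace X]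
    [BorelSpace X] [PolishSpace X] : SecondCountableTopology (ProbabilityMeasure X) := by
  let B := TopologicalSpace.countableBasis X
  have hBc : B.Countable := TopologicalSpace.countable_countableBasis X
  have hB : TopologicalSpace.IsTopologicalBasis B := TopologicalSpace.isBasis_countableBasis X
  let F : Set (Set (Set X)) := {s | s.Finite ∧ s ⊆ B}
  have hF : F.Countable := Set.countable_ofPred_finite_subset hBc
  let S : Set (Set (ProbabilityMeasure X)) :=
    Set.image2 (fun s (q : ℚ) => {μ : ProbabilityMeasure X |
      ENNReal.ofReal q < (μ : Measure X) (⋃₀ s)}) F Set.univ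
  have hS : S.Countable := hF.image2 (Set.countable_univ) _
  refine ⟨S, hS, ?_⟩
  apply le_antisymm
  · apply le_generateFrom
    rintro _ ⟨s, hs, q, -, rfl⟩
    exact isOpen_measure_gt (isOpen_sUnion fun t ht => hB.isOpen (hs.2 ht)) _
  · refine le_of_nhds_le_nhds fun μ => ?_
    have : (@nhds _ (TopologicalSpace.generateFrom S) μ).IsCountablyGenerated := by
      letI := TopologicalSpace.generateFrom S
      haveI : SecondCountableTopology (ProbabilityMeasure X) := ⟨S, hS, rfl⟩
      infer_instance
    change Tendsto (fun ν : ProbabilityMeasure X => ν)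
      (@nhds _ (TopologicalSpace.generateFrom S) μ) (𝓝 μ)
    refine tendsto_of_forall_isOpen_le_liminf' (fun G hG => ?_)
    obtain ⟨T, hTB, rfl⟩ := hB.open_eq_sUnion hG
    have hTc : T.Countable := hBc.mono hTB
    refine le_of_forall_lt fun a ha => ?_
    -- approximate by finite subunions
    have hfin : ∃ s : Set (Set X), s.Finite ∧ s ⊆ T ∧ a < (μ : Measure X) (⋃₀ s) := by
      rcases T.eq_empty_or_nonempty with rfl | hne
      · simp at ha
      obtain ⟨f, rfl⟩ := hTc.exists_eq_range hne
      rw [Set.sUnion_range, ← Set.iUnion_accumulate, (Set.monotone_accumulate).measure_iUnion,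
        lt_iSup_iff] at ha
      obtain ⟨n, hn⟩ := ha
      refine ⟨f '' Set.Iic n, (Set.finite_Iic n).image f, Set.image_subset_range _ _, ?_⟩
      rwa [Set.sUnion_image]
    obtain ⟨s, hsf, hsT, has⟩ := hfin
    obtain ⟨q, hq0, haq, hqs⟩ := ENNReal.lt_iff_exists_rat_btwn.1 has
    have hev : ∀ᶠ ν : ProbabilityMeasure X in @nhds _ (TopologicalSpace.generateFrom S) μ,
        ENNReal.ofReal q < (ν : Measure X) (⋃₀ s) := by
      letI := TopologicalSpace.generateFrom S
      have hmem : {ν : ProbabilityMeasure X | ENNReal.ofReal q < (ν : Measure X) (⋃₀ s)} ∈ S :=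
        ⟨s, ⟨hsf, hsT.trans hTB⟩, q, trivial, rfl⟩
      exact (TopologicalSpace.isOpen_generateFrom_of_mem hmem).mem_nhds hqs
    refine lt_of_lt_of_le haq ?_
    refine le_liminf_of_le (by isBoundedDefault) ?_
    filter_upwards [hev] with ν hν
    exact hν.le.trans (measure_mono (Set.sUnion_subset_sUnion hsT))

lemma lsc_lintegral {X : Type*} [MeasurableSpace X] [TopologicalSpace X] [BorelSpace X]
    [PolishSpace X] (c : X → ℝ≥0∞) (hc : LowerSemicontinuous c) :
    LowerSemicontinuous (fun μ : ProbabilityMeasure X => ∫⁻ x, c x ∂(μ : Measure X)) := by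
  have hcm : Measurable c := hc.measurable
  let f : ℕ → X → ℝ := fun n x => (min (c x) n).toReal
  have hfm : ∀ n, Measurable (f n) := fun n => (hcm.min measurable_const).ennreal_toReal
  have hne : ∀ (n : ℕ) x, min (c x) n ≠ ⊤ := fun n x =>
    ne_top_of_le_ne_top (ENNReal.natCast_ne_top n) (min_le_right _ _)
  have hof : ∀ n x, ENNReal.ofReal (f n x) = min (c x) n := fun n x =>
    ENNReal.ofReal_toReal (hne n x)
  have hsup : (fun μ : ProbabilityMeasure X => ∫⁻ x, c x ∂(μ : Measure X))
      = fun μ : ProbabilityMeasure X => ⨆ n, ∫⁻ x, ENNReal.ofReal (f n x) ∂(μ : Measure X) := by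
    funext μ
    rw [← lintegral_iSup (fun n => (hfm n).ennreal_ofReal)]
    · congr 1
      funext x
      simp_rw [hof]
      rw [← inf_iSup_eq, ENNReal.iSup_natCast, inf_top_eq]
    · intro m n hmn x
      simp only [hof]
      gcongr
  rw [hsup]
  refine lowerSemicontinuous_iSup fun n => ?_
  rw [lowerSemicontinuous_iff_isClosed_preimage]
  intro a
  apply IsSeqClosed.isClosed
  intro μs μ hμs hlim
  have key : ∫⁻ x, ENNReal.ofReal (f n x) ∂(μ : Measure X) ≤
      atTop.liminf (fun i => ∫⁻ x, ENNReal.ofReal (f n x) ∂(μs i : Measure X)) := by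
    have nn : 0 ≤ f n := fun x => ENNReal.toReal_nonneg
    simp_rw [lintegral_eq_lintegral_meas_lt _ (Eventually.of_forall nn) (hfm n).aemeasurable]
    calc ∫⁻ (t : ℝ) in Set.Ioi 0, (μ : Measure X) {a | t < f n a}
        ≤ ∫⁻ (t : ℝ) in Set.Ioi 0, atTop.liminf (fun i => (μs i : Measure X) {a | t < f n a}) := by
          refine setLIntegral_mono' measurableSet_Ioi fun t ht => ?_
          refine ProbabilityMeasure.le_liminf_measure_open_of_tendsto hlim ?_
          have : {a | t < f n a} = {a | ENNReal.ofReal t < c a} ∩ {a | ENNReal.ofReal t < n} := by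
            ext x
            simp only [Set.mem_ofPred_eq, Set.mem_inter_iff, f]
            rw [← ENNReal.ofReal_lt_iff_lt_toReal (le_of_lt ht) (hne n x), lt_min_iff]
          rw [this]
          exact (hc.isOpen_preimage _).inter isOpen_const
      _ ≤ _ := lintegral_liminf_le (fun n => Antitone.measurable (fun s t hst =>
            measure_mono (fun ω hω => lt_of_le_of_lt hst hω)))
  refine key.trans ?_
  refine liminf_le_of_frequently_le' (Frequently.of_forall fun i => hμs i)

/-- The pair of marginals. -/
def margPair (π : ProbabilityMeasure (X1 × X2)) : ProbabilityMeasure X1 × ProbabilityMeasure X2 :=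
  (margFst π, margSnd π)

lemma continuous_margFst : Continuous (margFst : ProbabilityMeasure (X1 × X2) → _) :=
  ProbabilityMeasure.continuous_map continuous_fst

lemma continuous_margSnd : Continuous (margSnd : ProbabilityMeasure (X1 × X2) → _) :=
  ProbabilityMeasure.continuous_map continuous_snd

lemma continuous_margPair : Continuous (margPair : ProbabilityMeasure (X1 × X2) → _) :=
  continuous_margFst.prodMk continuous_margSnd

lemma tight_of_isCompact {X : Type*} [MeasurableSpace X] [TopologicalSpace X] [BorelSpace X]
    [PolishSpace X] {K : Set (ProbabilityMeasure X)} (hK : IsCompact K) :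
    IsTightMeasureSet {((μ : ProbabilityMeasure X) : Measure X) | μ ∈ K} := by
  letI := TopologicalSpace.upgradeIsCompletelyMetrizable X
  exact isTightMeasureSet_of_isCompact_closure (by rwa [hK.isClosed.closure_eq])

lemma isProperMap_margPair : IsProperMap (margPair : ProbabilityMeasure (X1 × X2) → _) := by
  rw [isProperMap_iff_isCompact_preimage]
  refine ⟨continuous_margPair, fun K hK => ?_⟩
  have h1 := tight_of_isCompact (hK.image continuous_fst)
  have h2 := tight_of_isCompact (hK.image continuous_snd)
  have ht : IsTightMeasureSet {((π : ProbabilityMeasure (X1 × X2)) : Measure (X1 × X2)) |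
      π ∈ margPair ⁻¹' K} := by
    apply IsTightMeasureSet.prodMk
    · refine h1.subset ?_
      rintro _ ⟨_, ⟨π, hπ, rfl⟩, rfl⟩
      exact ⟨margFst π, ⟨_, hπ, rfl⟩, rfl⟩
    · refine h2.subset ?_
      rintro _ ⟨_, ⟨π, hπ, rfl⟩, rfl⟩
      exact ⟨margSnd π, ⟨_, hπ, rfl⟩, rfl⟩
  have := isCompact_closure_of_isTightMeasureSet ht
  rwa [(hK.isClosed.preimage continuous_margPair).closure_eq] at this

lemma mem_coupling_iff (π : ProbabilityMeasure (X1 × X2)) (μ : ProbabilityMeasure X1)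
    (ν : ProbabilityMeasure X2) : π ∈ Coupling μ ν ↔ margPair π = (μ, ν) := by
  rw [margPair, Prod.mk.injEq]
  exact and_congr ⟨fun h => Subtype.ext h, fun h => congrArg Subtype.val h⟩
    ⟨fun h => Subtype.ext h, fun h => congrArg Subtype.val h⟩

lemma lsc_OTCost (c : X1 × X2 → ℝ≥0∞) (hc : LowerSemicontinuous c) :
    LowerSemicontinuous
      (fun p : ProbabilityMeasure X1 × ProbabilityMeasure X2 => OTCost c p.1 p.2) := by
  rw [lowerSemicontinuous_iff_isClosed_preimage]
  intro a
  have : (fun p : ProbabilityMeasure X1 × ProbabilityMeasure X2 => OTCost c p.1 p.2) ⁻¹' Set.Iic a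
      = ⋂ b : Set.Ioi a, margPair '' (transportCost c ⁻¹' Set.Iic b.1) := by
    ext ⟨μ, ν⟩
    simp only [Set.mem_preimage, Set.mem_Iic, Set.mem_iInter, Set.mem_image]
    constructor
    · rintro h ⟨b, hb⟩
      have : OTCost c μ ν < b := lt_of_le_of_lt h hb
      simp only [OTCost, iInf_lt_iff] at this
      obtain ⟨π, hπ, hlt⟩ := this
      exact ⟨π, hlt.le, (mem_coupling_iff _ _ _).1 hπ⟩
    · intro h
      refine le_of_forall_gt_imp_ge_of_dense fun b hb => ?_
      obtain ⟨π, hπ, heq⟩ := h ⟨b, hb⟩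
      exact (iInf₂_le π ((mem_coupling_iff _ _ _).2 heq)).trans hπ
  rw [this]
  exact isClosed_iInter fun b => isProperMap_margPair.isClosedMap _
    ((lsc_lintegral c hc).isClosed_preimage _)

lemma measurable_transportCost (c : X1 × X2 → ℝ≥0∞) (hc : LowerSemicontinuous c) :
    Measurable (transportCost c) :=
  LowerSemicontinuous.measurable (lsc_lintegral c hc)

lemma measurable_OTCost (c : X1 × X2 → ℝ≥0∞) (hc : LowerSemicontinuous c) :
    Measurable (fun p : ProbabilityMeasure X1 × ProbabilityMeasure X2 => OTCost c p.1 p.2) :=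
  LowerSemicontinuous.measurable (lsc_OTCost c hc)

lemma measurable_margPair : Measurable (margPair : ProbabilityMeasure (X1 × X2) → _) :=
  continuous_margPair.measurable

lemma measurable_OTCost_marg (c : X1 × X2 → ℝ≥0∞) (hc : LowerSemicontinuous c) :
    Measurable (fun π : ProbabilityMeasure (X1 × X2) => OTCost c (margFst π) (margSnd π)) := by
  have := (measurable_OTCost c hc).comp measurable_margPair
  exact this

lemma OTCost_marg_le (c : X1 × X2 → ℝ≥0∞) (π : ProbabilityMeasure (X1 × X2)) :
    OTCost c (margFst π) (margSnd π) ≤ transportCost c π :=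
  iInf₂_le π ((mem_coupling_iff _ _ _).2 rfl)

end helpers

/-- Lemma 3.2, last part: assume `𝒞(M1,M2) < ∞`. A random coupling
`P ∈ RΓ(M1,M2)` attains the minimum in the random-coupling formulation of `𝒞(M1,M2)` if and
only if `(pr¹_♯, pr²_♯)_♯ P` is an optimal coupling for the cost `C` between `M1` and `M2`
and `P` is concentrated on the set of `c`-optimal couplings. -/
theorem randCoupling_optimal_iff
    (c : X1 × X2 → ℝ≥0∞) (hc : LowerSemicontinuous c)
    (M1 : ProbabilityMeasure (ProbabilityMeasure X1))
    (M2 : ProbabilityMeasure (ProbabilityMeasure X2))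
    (hfin : IterOTCost c M1 M2 ≠ ⊤)
    (P : ProbabilityMeasure (ProbabilityMeasure (X1 × X2))) (hP : P ∈ RandCoupling M1 M2) :
    (∫⁻ π, transportCost c π ∂(P : Measure (ProbabilityMeasure (X1 × X2))))
        = IterOTCost c M1 M2
      ↔ ((margPairLaw P).map Prod.fst = (M1 : Measure (ProbabilityMeasure X1))
          ∧ (margPairLaw P).map Prod.snd = (M2 : Measure (ProbabilityMeasure X2))
          ∧ (∫⁻ p, OTCost c p.1 p.2 ∂(margPairLaw P)) = IterOTCost c M1 M2)
        ∧ (P : Measure (ProbabilityMeasure (X1 × X2))) (OptPlans c) = 1 := by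
  have hTm := measurable_transportCost c hc
  have hOm := measurable_OTCost c hc
  have hpm := measurable_margPair (X1 := X1) (X2 := X2)
  have hGm := measurable_OTCost_marg c hc
  have hle := OTCost_marg_le c
  have hfst : (margPairLaw P).map Prod.fst = (M1 : Measure (ProbabilityMeasure X1)) := by
    rw [← hP.1]
    exact Measure.map_map measurable_fst hpm
  have hsnd : (margPairLaw P).map Prod.snd = (M2 : Measure (ProbabilityMeasure X2)) := by
    rw [← hP.2]
    exact Measure.map_map measurable_snd hpm
  have hint : (∫⁻ p, OTCost c p.1 p.2 ∂(margPairLaw P))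
      = ∫⁻ π, OTCost c (margFst π) (margSnd π) ∂(P : Measure (ProbabilityMeasure (X1 × X2))) :=
    lintegral_map hOm hpm
  have hprob : IsProbabilityMeasure (margPairLaw P) :=
    Measure.isProbabilityMeasure_map hpm.aemeasurable
  have hIter : IterOTCost c M1 M2 ≤ ∫⁻ p, OTCost c p.1 p.2 ∂(margPairLaw P) :=
    iInf₂_le (⟨margPairLaw P, hprob⟩ :
      ProbabilityMeasure (ProbabilityMeasure X1 × ProbabilityMeasure X2)) ⟨hfst, hsnd⟩
  have hmono := lintegral_mono (μ := (P : Measure (ProbabilityMeasure (X1 × X2)))) hle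
  have hopt : MeasurableSet (OptPlans c) := measurableSet_eq_fun hTm hGm
  have hone : (P : Measure (ProbabilityMeasure (X1 × X2))) (OptPlans c) = 1 ↔
      ∀ᵐ π ∂(P : Measure (ProbabilityMeasure (X1 × X2))),
        transportCost c π = OTCost c (margFst π) (margSnd π) :=
    (prob_compl_eq_zero_iff hopt).symm
  rw [hone]
  constructor
  · intro h
    have heq : (∫⁻ p, OTCost c p.1 p.2 ∂(margPairLaw P)) = IterOTCost c M1 M2 :=
      le_antisymm (by rw [hint, ← h]; exact hmono) hIter
    refine ⟨⟨hfst, hsnd, heq⟩, ?_⟩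
    have hae := ae_eq_of_ae_le_of_lintegral_le (Filter.Eventually.of_forall hle)
      (by rw [← hint, heq]; exact hfin) hTm.aemeasurable (by rw [h, ← hint, heq])
    filter_upwards [hae] with π hπ using hπ.symm
  · rintro ⟨⟨-, -, heq⟩, hae⟩
    rw [lintegral_congr_ae hae, ← hint, heq]

end OTRM
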